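/- There exists a constant C > 0 (independent of R) such that ‖f_R‖_{L²(ℝⁿ)} ≤ C·R^{(α(n−2)+4γ)/4} for all R > 2. -/

import Mathlib

open MeasureTheory Filter

noncomputable section

/-- Euclidean norm on `Fin m → ℝ`. -/
def euclNorm {m : ℕ} (y : Fin m → ℝ) : ℝ := Real.sqrt (∑ i, y i ^ 2)

/-- For even `m`, the `m × m` block-diagonal matrix with `m/2` diagonal blocks
`σ = ![![0,1],![-1,0]]`. -/
def omegaMat (m : ℕ) : Matrix (Fin m) (Fin m) ℝ := fun i j =>
  if i.val % 2 = 0 ∧ j.val = i.val + 1 then 1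
  else if j.val % 2 = 0 ∧ i.val = j.val + 1 then -1
  else 0

/-- The `n × n` matrix whose upper-left `k × k` block is `Ω_k` and whose remaining
entries vanish. -/
def Mmat (n k : ℕ) : Matrix (Fin n) (Fin n) ℝ := fun i j =>
  if i.val < k ∧ j.val < k then
    (if i.val % 2 = 0 ∧ j.val = i.val + 1 then 1
     else if j.val % 2 = 0 ∧ i.val = j.val + 1 then -1
     else 0)
  else 0

/-- `i`-th partial derivative of a function on `Fin m → ℝ`. -/
def pd {m : ℕ} (f : (Fin m → ℝ) → ℂ) (i : Fin m) (y : Fin m → ℝ) : ℂ :=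
  fderiv ℝ f y (Pi.single i 1)

/-- Laplacian on `Fin m → ℝ`. -/
def lapV {m : ℕ} (f : (Fin m → ℝ) → ℂ) (y : Fin m → ℝ) : ℂ :=
  ∑ i, pd (pd f i) i y

/-- Twisted Laplacian (Landau Hamiltonian)
`T v = -Δv + 2i (Ω_m y)·∇v + |y|² v` on `Fin m → ℝ`. -/
def twistedLap (m : ℕ) (f : (Fin m → ℝ) → ℂ) (y : Fin m → ℝ) : ℂ :=
  - lapV f y + 2 * Complex.I * ∑ i, (((omegaMat m).mulVec y i : ℝ) : ℂ) * pd f i y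
    + ((euclNorm y ^ 2 : ℝ) : ℂ) * f y

/-- `L^q` norm (with real exponent) of a complex-valued function. -/
def LqNorm {X : Type*} [MeasureSpace X] (q : ℝ) (f : X → ℂ) : ℝ :=
  (eLpNorm f (ENNReal.ofReal q) volume).toReal

/-- Mixed norm `‖u‖_{L^p((0,T);L^q)}`. -/
def mixedNorm {X : Type*} [MeasureSpace X] (p q T : ℝ) (u : ℝ → X → ℂ) : ℝ :=
  (∫ t in Set.Ioo (0:ℝ) T, LqNorm q (u t) ^ p) ^ (1/p)

/-- A smooth compactly supported cutoff `ψ` with `0 ≤ ψ ≤ 1`, `ψ s = 0` for `|s| > 1`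
and `ψ s = 1` for `|s| < 1/2`. -/
def IsCutoff (ψ : ℝ → ℝ) : Prop :=
  ContDiff ℝ (⊤ : ℕ∞) ψ ∧ HasCompactSupport ψ ∧ (∀ s, 0 ≤ ψ s ∧ ψ s ≤ 1) ∧
    (∀ s, 1 < |s| → ψ s = 0) ∧ (∀ s, |s| < 1/2 → ψ s = 1)

/-- `v` is a smooth nonzero eigenfunction of the twisted Laplacian on `Fin m → ℝ`
with eigenvalue `lam`, such that `v` and `∇v` lie in every `L^p`, `1 ≤ p < ∞`. -/
def IsEigen (m : ℕ) (lam : ℝ) (v : (Fin m → ℝ) → ℂ) : Prop :=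
  ContDiff ℝ (⊤ : ℕ∞) v ∧ v ≠ 0 ∧ (∀ y, twistedLap m v y = (lam : ℂ) * v y) ∧
    (∀ p : ℝ, 1 ≤ p → MemLp v (ENNReal.ofReal p) volume) ∧
    (∀ p : ℝ, 1 ≤ p → ∀ i, MemLp (pd v i) (ENNReal.ofReal p) volume)

/-- Schrödinger admissibility: `p, q ≥ 2` and `2/p = n/2 - n/q`. -/
def SAdmissible (n : ℕ) (p q : ℝ) : Prop :=
  2 ≤ p ∧ 2 ≤ q ∧ 2 / p = (n : ℝ) / 2 - (n : ℝ) / q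

/-- Euclidean norm of `x = (y,z) ∈ ℝ^{n-2} × ℝ²`. -/
def pairNormE {m : ℕ} (x : (Fin m → ℝ) × (Fin 2 → ℝ)) : ℝ :=
  Real.sqrt (euclNorm x.1 ^ 2 + euclNorm x.2 ^ 2)

/-- `W(t,y,z) = e^{iλt/|z|^α} v(y/|z|^{α/2})` in the even case. -/
def WfunE (m : ℕ) (α lam : ℝ) (v : (Fin m → ℝ) → ℂ) (t : ℝ)
    (x : (Fin m → ℝ) × (Fin 2 → ℝ)) : ℂ :=
  Complex.exp (Complex.I * ((lam * t / euclNorm x.2 ^ α : ℝ) : ℂ))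
    * v (fun i => x.1 i / euclNorm x.2 ^ (α/2))

/-- `W_R(t,y,z) = W(t,y,z) ψ_R¹(z) ψ_R²(z) ψ(|y|²/|z|²)`. -/
def WRfunE (m : ℕ) (α lam : ℝ) (v : (Fin m → ℝ) → ℂ) (ψ : ℝ → ℝ) (γ R : ℝ)
    (t : ℝ) (x : (Fin m → ℝ) × (Fin 2 → ℝ)) : ℂ :=
  WfunE m α lam v t x * ((ψ ((x.2 0 - R) / R ^ γ) : ℝ) : ℂ)
    * ((ψ ((x.2 1 - R) / R ^ γ) : ℝ) : ℂ)
    * ((ψ (euclNorm x.1 ^ 2 / euclNorm x.2 ^ 2) : ℝ) : ℂ)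

/-- Initial datum `f_R = W_R(0,·)` in the even case. -/
def fRfunE (m : ℕ) (α lam : ℝ) (v : (Fin m → ℝ) → ℂ) (ψ : ℝ → ℝ) (γ R : ℝ) :
    (Fin m → ℝ) × (Fin 2 → ℝ) → ℂ :=
  WRfunE m α lam v ψ γ R 0

/-- Partial derivative in the `i`-th `y` direction on `(Fin m → ℝ) × (Fin 2 → ℝ)`. -/
def pdYE {m : ℕ} (f : (Fin m → ℝ) × (Fin 2 → ℝ) → ℂ) (i : Fin m)
    (x : (Fin m → ℝ) × (Fin 2 → ℝ)) : ℂ :=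
  fderiv ℝ f x (Pi.single i 1, 0)

/-- Partial derivative in the `j`-th `z` direction on `(Fin m → ℝ) × (Fin 2 → ℝ)`. -/
def pdZE {m : ℕ} (f : (Fin m → ℝ) × (Fin 2 → ℝ) → ℂ) (j : Fin 2)
    (x : (Fin m → ℝ) × (Fin 2 → ℝ)) : ℂ :=
  fderiv ℝ f x (0, Pi.single j 1)

/-- Full spatial Laplacian on `(Fin m → ℝ) × (Fin 2 → ℝ) ≃ ℝⁿ`. -/
def lapXE {m : ℕ} (f : (Fin m → ℝ) × (Fin 2 → ℝ) → ℂ)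
    (x : (Fin m → ℝ) × (Fin 2 → ℝ)) : ℂ :=
  (∑ i, pdYE (pdYE f i) i x) + ∑ j, pdZE (pdZE f j) j x

/-- Divergence of a vector field on `(Fin m → ℝ) × (Fin 2 → ℝ)`. -/
def divXE {m : ℕ}
    (b : (Fin m → ℝ) × (Fin 2 → ℝ) → (Fin m → ℝ) × (Fin 2 → ℝ))
    (x : (Fin m → ℝ) × (Fin 2 → ℝ)) : ℝ :=
  (∑ i, fderiv ℝ (fun x' => (b x').1 i) x (Pi.single i 1, 0))
    + ∑ j, fderiv ℝ (fun x' => (b x').2 j) x (0, Pi.single j 1)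

/-- `a · ∇u` on `(Fin m → ℝ) × (Fin 2 → ℝ)`. -/
def dotGradE {m : ℕ} (a : (Fin m → ℝ) × (Fin 2 → ℝ))
    (u : (Fin m → ℝ) × (Fin 2 → ℝ) → ℂ) (x : (Fin m → ℝ) × (Fin 2 → ℝ)) : ℂ :=
  (∑ i, ((a.1 i : ℝ) : ℂ) * pdYE u i x) + ∑ j, ((a.2 j : ℝ) : ℂ) * pdZE u j x

/-- Squared Euclidean length of a vector of `(Fin m → ℝ) × (Fin 2 → ℝ)`. -/
def normSqPairE {m : ℕ} (a : (Fin m → ℝ) × (Fin 2 → ℝ)) : ℝ :=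
  euclNorm a.1 ^ 2 + euclNorm a.2 ^ 2

/-- Magnetic operator `(∇ - ia)² u = Δu - 2i a·∇u - i (div a) u - |a|² u`, even case. -/
def magSqE {m : ℕ}
    (a : (Fin m → ℝ) × (Fin 2 → ℝ) → (Fin m → ℝ) × (Fin 2 → ℝ))
    (u : (Fin m → ℝ) × (Fin 2 → ℝ) → ℂ) (x : (Fin m → ℝ) × (Fin 2 → ℝ)) : ℂ :=
  lapXE u x - 2 * Complex.I * dotGradE (a x) u x - Complex.I * ((divXE a x : ℝ) : ℂ) * u x
    - ((normSqPairE (a x) : ℝ) : ℂ) * u x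

/-- The vector field `|z|^{-α} M(y,0,0)ᵗ = |z|^{-α} (Ω_m y, 0, 0)`. -/
def aZE (m : ℕ) (α : ℝ) (x : (Fin m → ℝ) × (Fin 2 → ℝ)) :
    (Fin m → ℝ) × (Fin 2 → ℝ) :=
  (fun i => euclNorm x.2 ^ (-α) * (omegaMat m).mulVec x.1 i, 0)

/-- `F_R = i ∂_t W_R - (∇ - i |z|^{-α} M(y,0,0)ᵗ)² W_R`, even case. -/
def FRfunE (m : ℕ) (α lam : ℝ) (v : (Fin m → ℝ) → ℂ) (ψ : ℝ → ℝ) (γ R : ℝ)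
    (t : ℝ) (x : (Fin m → ℝ) × (Fin 2 → ℝ)) : ℂ :=
  Complex.I * deriv (fun s => WRfunE m α lam v ψ γ R s x) t
    - magSqE (aZE m α) (WRfunE m α lam v ψ γ R t) x

/-- The magnetic potential `A(x) = |x|^{-α} M x = |x|^{-α} (Ω_m y, 0, 0)` in split
coordinates `x = (y,z) ∈ ℝ^{n-2} × ℝ²`. -/
def AsplitE (m : ℕ) (α : ℝ) (x : (Fin m → ℝ) × (Fin 2 → ℝ)) :
    (Fin m → ℝ) × (Fin 2 → ℝ) :=
  (fun i => pairNormE x ^ (-α) * (omegaMat m).mulVec x.1 i, 0)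

/-- Residual `i ∂_t u - Δu + 2i A·∇u + |A|² u`, even case. -/
def residOpE (m : ℕ) (α : ℝ) (u : ℝ → (Fin m → ℝ) × (Fin 2 → ℝ) → ℂ)
    (t : ℝ) (x : (Fin m → ℝ) × (Fin 2 → ℝ)) : ℂ :=
  Complex.I * deriv (fun s => u s x) t - lapXE (u t) x
    + 2 * Complex.I * dotGradE (AsplitE m α x) (u t) x
    + ((normSqPairE (AsplitE m α x) : ℝ) : ℂ) * u t x

/-- Time-truncated residual `F̃_R`, even case. -/
def FtildeRE (m : ℕ) (α lam : ℝ) (v : (Fin m → ℝ) → ℂ) (ψ : ℝ → ℝ)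
    (γ R β : ℝ) (t : ℝ) (x : (Fin m → ℝ) × (Fin 2 → ℝ)) : ℂ :=
  if 0 < t ∧ t < R ^ β then residOpE m α (WRfunE m α lam v ψ γ R) t x else 0

lemma aux_scale {m : ℕ} (v : (Fin m → ℝ) → ℂ) (hv : Continuous v) (c : ℝ) (hc : 0 < c) :
    ∫⁻ y : Fin m → ℝ, ‖v (fun i => y i / c)‖ₑ ^ (2:ℝ) =
      ENNReal.ofReal (c ^ m) * ∫⁻ y, ‖v y‖ₑ ^ (2:ℝ) := by
  have h1 := Measure.map_addHaar_smul (volume : Measure (Fin m → ℝ)) (inv_ne_zero hc.ne')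
  have hm : Measurable (fun y : Fin m → ℝ => ‖v y‖ₑ ^ (2:ℝ)) := by
    have := hv.measurable
    fun_prop
  have h2 : ∫⁻ y : Fin m → ℝ, ‖v (fun i => y i / c)‖ₑ ^ (2:ℝ) =
      ∫⁻ y, ‖v y‖ₑ ^ (2:ℝ) ∂(Measure.map (c⁻¹ • ·) (volume : Measure (Fin m → ℝ))) := by
    rw [lintegral_map hm (measurable_const_smul _)]
    congr 1
    ext y
    congr 4
    ext i
    simp [div_eq_inv_mul]
  rw [h2, h1, lintegral_smul_measure]
  simp [abs_of_pos hc]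

lemma aux_enorm_cutoff (ψ : ℝ → ℝ) (hψ : IsCutoff ψ) (s : ℝ) : ‖((ψ s : ℝ) : ℂ)‖ ≤ 1 := by
  rw [Complex.norm_real, Real.norm_eq_abs, abs_of_nonneg (hψ.2.2.1 s).1]
  exact (hψ.2.2.1 s).2

lemma aux_meas_eucl {m : ℕ} : Measurable (fun y : Fin m → ℝ => euclNorm y) := by
  unfold euclNorm
  fun_prop

lemma aux_meas {m : ℕ} (α lam : ℝ) (v : (Fin m → ℝ) → ℂ) (hv : Continuous v)
    (ψ : ℝ → ℝ) (hψ : Continuous ψ) (γ R : ℝ) : Measurable (fRfunE m α lam v ψ γ R) := by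
  unfold fRfunE WRfunE WfunE
  have h1 := hv.measurable
  have h2 := hψ.measurable
  have h3 := @aux_meas_eucl m
  have h4 := @aux_meas_eucl 2
  have h5 : Measurable (fun x : (Fin m → ℝ) × (Fin 2 → ℝ) => fun i => x.1 i / euclNorm x.2 ^ (α/2)) := by
    refine measurable_pi_lambda _ fun i => ?_
    fun_prop
  have h6 := h1.comp h5
  simp only [Function.comp_def] at h6
  fun_prop

lemma aux_zero {m : ℕ} (α lam : ℝ) (v : (Fin m → ℝ) → ℂ) 
    (ψ : ℝ → ℝ) (hψ : IsCutoff ψ) (γ R : ℝ) (hR : 0 < R) (x : (Fin m → ℝ) × (Fin 2 → ℝ))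
    (hx : x.2 ∉ Set.Icc (fun _ : Fin 2 => R - R ^ γ) (fun _ => R + R ^ γ)) :
    fRfunE m α lam v ψ γ R x = 0 := by
  have hp : 0 < R ^ γ := Real.rpow_pos_of_pos hR γ
  have key : ∀ s : ℝ, ¬ (R - R ^ γ ≤ s ∧ s ≤ R + R ^ γ) → ψ ((s - R) / R ^ γ) = 0 := by
    intro s hs
    apply hψ.2.2.2.1
    rw [abs_div, abs_of_pos hp, lt_div_iff₀ hp, one_mul]
    by_contra h
    push Not at h
    rw [abs_le] at h
    exact hs ⟨by linarith, by linarith⟩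
  unfold fRfunE WRfunE
  by_cases h0 : R - R ^ γ ≤ x.2 0 ∧ x.2 0 ≤ R + R ^ γ
  · by_cases h1 : R - R ^ γ ≤ x.2 1 ∧ x.2 1 ≤ R + R ^ γ
    · exfalso
      apply hx
      constructor
      · intro i
        fin_cases i
        exacts [h0.1, h1.1]
      · intro i
        fin_cases i
        exacts [h0.2, h1.2]
    · rw [key _ h1]; simp
  · rw [key _ h0]; simp

lemma aux_norm {m : ℕ} (α lam : ℝ) (v : (Fin m → ℝ) → ℂ) 
    (ψ : ℝ → ℝ) (hψ : IsCutoff ψ) (γ R : ℝ) (y : Fin m → ℝ) (z : Fin 2 → ℝ) :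
    ‖fRfunE m α lam v ψ γ R (y, z)‖ ≤ ‖v (fun i => y i / euclNorm z ^ (α/2))‖ := by
  unfold fRfunE WRfunE WfunE
  simp only [mul_zero, zero_div, Complex.ofReal_zero, Complex.exp_zero, one_mul]
  rw [norm_mul, norm_mul, norm_mul]
  have h := aux_enorm_cutoff ψ hψ
  refine (mul_le_of_le_one_right (by positivity) (h _)).trans ?_
  refine (mul_le_of_le_one_right (by positivity) (h _)).trans ?_
  exact (mul_le_of_le_one_right (by positivity) (h _))

lemma aux_eucl (γ R : ℝ) (hγ2 : γ < 1) (hR : 2 < R) (z : Fin 2 → ℝ)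
    (hz : z ∈ Set.Icc (fun _ : Fin 2 => R - R ^ γ) (fun _ => R + R ^ γ)) :
    0 < euclNorm z ∧ euclNorm z ≤ 3 * R := by
  have h1 : R ^ γ < R := by
    conv_rhs => rw [← Real.rpow_one R]
    exact Real.rpow_lt_rpow_of_exponent_lt (by linarith) hγ2
  have a0 := hz.1 0
  have a1 := hz.1 1
  have b0 := hz.2 0
  have b1 := hz.2 1
  simp only at a0 a1 b0 b1
  unfold euclNorm
  rw [Fin.sum_univ_two]
  constructor
  · apply Real.sqrt_pos.mpr
    have : 0 < z 0 := by linarith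
    positivity
  · apply Real.sqrt_le_iff.mpr
    constructor
    · linarith
    · nlinarith

lemma aux_lint {m : ℕ} (α lam : ℝ) (hα : 0 < α) (v : (Fin m → ℝ) → ℂ) (hv : Continuous v)
    (ψ : ℝ → ℝ) (hψ : IsCutoff ψ) (γ R : ℝ) (hγ2 : γ < 1) (hR : 2 < R) :
    ∫⁻ x, ‖fRfunE m α lam v ψ γ R x‖ₑ ^ (2:ℝ) ≤
      ENNReal.ofReal (((3 * R) ^ (α/2)) ^ m) * (∫⁻ y, ‖v y‖ₑ ^ (2:ℝ)) *
        (ENNReal.ofReal (2 * R ^ γ)) ^ 2 := by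
  have hm := aux_meas α lam v hv ψ hψ.1.continuous γ R
  rw [Measure.volume_eq_prod, lintegral_prod_symm' _ (by fun_prop)]
  set S := Set.Icc (fun _ : Fin 2 => R - R ^ γ) (fun _ => R + R ^ γ) with hS
  set D := ENNReal.ofReal (((3 * R) ^ (α/2)) ^ m) * (∫⁻ y, ‖v y‖ₑ ^ (2:ℝ)) with hD
  have hvol : volume S = (ENNReal.ofReal (2 * R ^ γ)) ^ 2 := by
    rw [hS, Real.volume_Icc_pi]
    simp only [Finset.prod_const, Finset.card_univ, Fintype.card_fin]
    congr 2
    ring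
  calc _ ≤ ∫⁻ z, S.indicator (fun _ => D) z := by
        refine lintegral_mono fun z => ?_
        by_cases hz : z ∈ S
        · rw [Set.indicator_of_mem hz]
          obtain ⟨p, q⟩ := aux_eucl γ R hγ2 hR z hz
          have hc : 0 < euclNorm z ^ (α/2) := Real.rpow_pos_of_pos p _
          calc _ ≤ ∫⁻ y : Fin m → ℝ, ‖v (fun i => y i / euclNorm z ^ (α/2))‖ₑ ^ (2:ℝ) := by
                refine lintegral_mono fun y => ?_
                refine ENNReal.rpow_le_rpow ?_ (by norm_num)
                exact enorm_le_iff_norm_le.mpr (aux_norm α lam v ψ hψ γ R y z)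
            _ = _ := aux_scale v hv _ hc
            _ ≤ _ := by
                rw [hD]
                gcongr
        · rw [Set.indicator_of_notMem hz]
          simp [aux_zero α lam v ψ hψ γ R (by linarith) (_, z) hz]
    _ = D * volume S := lintegral_indicator_const measurableSet_Icc _
    _ = _ := by rw [hvol]

/-- `‖f_R‖_{L²} ≤ C R^{(α(n-2)+4γ)/4}`, even case. -/
theorem fR_L2_bound_even (n : ℕ) (hn : 4 ≤ n) (heven : Even n)
    (α : ℝ) (hα1 : 1 < α) (hα2 : α < 2)
    (lam : ℝ) (v : (Fin (n-2) → ℝ) → ℂ) (hv : IsEigen (n-2) lam v)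
    (ψ : ℝ → ℝ) (hψ : IsCutoff ψ) (γ : ℝ) (hγ1 : 1/2 < γ) (hγ2 : γ < 1) :
    ∃ C : ℝ, 0 < C ∧ ∀ R : ℝ, 2 < R →
      (eLpNorm (fRfunE (n-2) α lam v ψ γ R) 2 volume).toReal ≤
        C * R ^ ((α * ((n:ℝ) - 2) + 4*γ) / 4) := by
  have hvc : Continuous v := hv.1.continuous
  have hmem : MemLp v 2 volume := by
    have := hv.2.2.2.1 2 (by norm_num)
    simpa using this
  have htwo : ∀ {X : Type} [MeasureSpace X] (f : X → ℂ),
      eLpNorm f 2 volume ^ (2:ℝ) = ∫⁻ x, ‖f x‖ₑ ^ (2:ℝ) := by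
    intro X _ f
    have := eLpNorm_nnreal_pow_eq_lintegral (μ := (volume : Measure X)) (f := f) (p := 2) (by norm_num)
    simpa using this
  have hmR : ((n - 2 : ℕ) : ℝ) = (n : ℝ) - 2 := by
    rw [Nat.cast_sub (by omega)]; norm_num
  set N := (eLpNorm v 2 volume).toReal with hN
  have hN0 : 0 ≤ N := ENNReal.toReal_nonneg
  set K := 3 ^ (α * ((n:ℝ) - 2) / 4) * N * 2 with hK
  have hK0 : 0 ≤ K := by positivity
  refine ⟨K + 1, by linarith, fun R hR => ?_⟩
  have hR0 : 0 < R := by linarith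
  have hlint := aux_lint α lam (by linarith) v hvc ψ hψ γ R hγ2 hR
  rw [← htwo, ← htwo] at hlint
  have hreal := ENNReal.toReal_mono (by
    refine ENNReal.mul_ne_top (ENNReal.mul_ne_top ENNReal.ofReal_ne_top ?_) (by finiteness)
    exact ENNReal.rpow_ne_top_of_nonneg (by norm_num) hmem.2.ne) hlint
  rw [ENNReal.toReal_mul, ENNReal.toReal_mul, ENNReal.toReal_pow, ← ENNReal.toReal_rpow,
    ← ENNReal.toReal_rpow, ENNReal.toReal_ofReal (by positivity),
    ENNReal.toReal_ofReal (by positivity), Real.rpow_two, Real.rpow_two, ← hN] at hreal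
  have hexp : ((3 * R) ^ (α/2)) ^ (n-2) * N ^ 2 * (2 * R ^ γ) ^ 2 =
      (K * R ^ ((α * ((n:ℝ) - 2) + 4*γ) / 4)) ^ 2 := by
    have e1 : ((3 * R) ^ (α/2)) ^ (n-2) = ((3 * R) ^ (α * ((n:ℝ) - 2) / 4)) ^ 2 := by
      rw [← Real.rpow_natCast, ← Real.rpow_natCast, ← Real.rpow_mul (by positivity),
        ← Real.rpow_mul (by positivity), hmR]
      congr 1
      push_cast
      ring
    have e2 : R ^ ((α * ((n:ℝ) - 2) + 4*γ) / 4) = R ^ (α * ((n:ℝ) - 2) / 4) * R ^ γ := by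
      rw [← Real.rpow_add hR0]
      congr 1
      ring
    rw [e1, e2, hK, Real.mul_rpow (by norm_num) hR0.le]
    ring
  rw [hexp] at hreal
  have h := abs_le_of_sq_le_sq hreal (by positivity)
  refine (le_abs_self _).trans (h.trans ?_)
  gcongr
  linarith
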